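/- Let n ≥ 1 be an integer, let p, r be positive integers, set u_p = 2^(1−p) and u_{p+r} = 2^(1−p−r), and let a_0, …, a_n, x be real numbers. On a probability space, let δ_0 = 0 and let δ_1, …, δ_{2n}, β_1, …, β_{2n} be real random variables such that almost surely |δ_k| ≤ u_p, |β_k| ≤ u_{p+r}, and |δ_k − β_k| ≤ u_p for all 1 ≤ k ≤ 2n, and such that the random variables α_k := δ_k − β_k (1 ≤ k ≤ 2n) are mean independent. Define the computed Horner value P̂ = Σ_{i=0}^{n} a_i x^i ∏_{k=2(n−i)}^{2n} (1 + δ_k) and the exact value P = Σ_{i=0}^{n} a_i x^i. Then for every 0 < λ < 1, with probability at least 1 − λ, |P̂ − P| ≤ (Σ_{i=0}^{n} |a_i| |x|^i) · ( √(u_p · γ_{4n}(u_p)) · √(ln(2/λ)) + γ_{2n}(u_p + u_{p+r}) − γ_{2n}(u_p) ). -/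

import Mathlib

open MeasureTheory

/-- `γ_m(x) = (1+x)^m - 1`. -/
noncomputable def gammaFn (m : ℕ) (x : ℝ) : ℝ := (1 + x) ^ m - 1

open ProbabilityTheory
open scoped NNReal

section Products

variable {ι : Type*}

lemma abs_prod_le_pow {s : Finset ι} {y : ι → ℝ} {Y : ℝ} (hy : ∀ i ∈ s, |y i| ≤ Y) :
    |∏ i ∈ s, y i| ≤ Y ^ s.card := by
  rw [Finset.abs_prod, ← Finset.prod_const]
  exact Finset.prod_le_prod (fun _ _ => abs_nonneg _) hy

lemma abs_prod_sub_prod_le {s : Finset ι} {x y : ι → ℝ} {Y v : ℝ} (hY : 0 ≤ Y) (hv : 0 ≤ v)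
    (hy : ∀ i ∈ s, |y i| ≤ Y) (hxy : ∀ i ∈ s, |x i - y i| ≤ v) :
    |∏ i ∈ s, x i - ∏ i ∈ s, y i| ≤ (Y + v) ^ s.card - Y ^ s.card := by
  classical
  induction s using Finset.induction_on with
  | empty => simp
  | insert i s his ih =>
    have ih' := ih (fun j hj => hy j (Finset.mem_insert_of_mem hj))
      (fun j hj => hxy j (Finset.mem_insert_of_mem hj))
    have hx : |∏ j ∈ s, x j| ≤ (Y + v) ^ s.card := by
      refine abs_prod_le_pow fun j hj => ?_
      have h₁ := hy j (Finset.mem_insert_of_mem hj)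
      have h₂ := hxy j (Finset.mem_insert_of_mem hj)
      calc |x j| = |y j + (x j - y j)| := by ring_nf
        _ ≤ |y j| + |x j - y j| := abs_add_le _ _
        _ ≤ Y + v := add_le_add h₁ h₂
    rw [Finset.prod_insert his, Finset.prod_insert his, Finset.card_insert_of_notMem his]
    calc |x i * ∏ j ∈ s, x j - y i * ∏ j ∈ s, y j|
        = |(x i - y i) * ∏ j ∈ s, x j + y i * (∏ j ∈ s, x j - ∏ j ∈ s, y j)| := by ring_nf
      _ ≤ |x i - y i| * |∏ j ∈ s, x j| + |y i| * |∏ j ∈ s, x j - ∏ j ∈ s, y j| := by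
          rw [← abs_mul, ← abs_mul]; exact abs_add_le _ _
      _ ≤ v * (Y + v) ^ s.card + Y * ((Y + v) ^ s.card - Y ^ s.card) := by
          gcongr
          · exact hxy i (Finset.mem_insert_self _ _)
          · exact hy i (Finset.mem_insert_self _ _)
      _ = _ := by ring

lemma monotone_add_pow_sub_pow {Y v : ℝ} (hY : 1 ≤ Y) (hv : 0 ≤ v) :
    Monotone fun m : ℕ => (Y + v) ^ m - Y ^ m := by
  refine monotone_nat_of_le_succ fun m => ?_
  have h : Y ^ m * (Y - 1) ≤ (Y + v) ^ m * (Y + v - 1) := by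
    gcongr <;> linarith
  simp only [pow_succ]
  linarith

lemma prod_Icc_one_add_sub_one (z : ℕ → ℝ) (s N : ℕ) :
    ∏ k ∈ Finset.Icc s N, (1 + z k) - 1 =
      ∑ k ∈ Finset.range (N + 1),
        if s ≤ k then (∏ j ∈ Finset.Ico s k, (1 + z j)) * z k else 0 := by
  have h : ∀ M, ∏ k ∈ Finset.Ico s M, (1 + z k) - 1 =
      ∑ k ∈ Finset.range M, if s ≤ k then (∏ j ∈ Finset.Ico s k, (1 + z j)) * z k else 0 := by
    intro M
    induction M with
    | zero => simp
    | succ M ih =>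
      rw [Finset.sum_range_succ, ← ih]
      split_ifs with hM
      · rw [Finset.prod_Ico_succ_top hM]; ring
      · rw [Finset.Ico_eq_empty (by omega), Finset.Ico_eq_empty (by omega)]; simp
  exact h (N + 1)

end Products

section Azuma

variable {Ω : Type*} {m mΩ : MeasurableSpace Ω} {μ : Measure Ω} [IsProbabilityMeasure μ]

/-- Adding a bounded increment of vanishing conditional mean to a sub-Gaussian variable. -/
lemma hasSubgaussianMGF_add_of_condExp_eq_zero (hm : m ≤ mΩ) {S D : Ω → ℝ} {V c : ℝ≥0}
    (hS : HasSubgaussianMGF S V μ) (hSm : Measurable[m] S) (hD : Measurable D)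
    (hDc : ∀ᵐ ω ∂μ, |D ω| ≤ c) (hD0 : μ[D | m] =ᵐ[μ] 0) :
    HasSubgaussianMGF (fun ω => S ω + D ω) (V + c ^ 2) μ := by
  have hbound : ∀ t : ℝ, ∀ᵐ ω ∂μ, Real.exp (t * D ω) ≤
      Real.cosh (t * c) + D ω * (Real.sinh (t * c) / c) := by
    intro t
    filter_upwards [hDc] with ω hω
    rcases eq_or_ne c 0 with rfl | hc
    · have : D ω = 0 := by simpa using hω
      simp [this]
    · have hc' : (0 : ℝ) < c := by positivity
      have h := Real.exp_mul_le_cosh_add_mul_sinh (t := D ω / c)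
        (by rwa [abs_div, abs_of_pos hc', div_le_one hc']) (t * c)
      have e₁ : D ω / c * (t * c) = t * D ω := by field_simp
      have e₂ : D ω / c * Real.sinh (t * c) = D ω * (Real.sinh (t * c) / c) := by ring
      rwa [e₁, e₂] at h
  have hDint : Integrable D μ := .of_bound hD.aestronglyMeasurable c hDc
  have hexpD : ∀ t : ℝ, ∀ᵐ ω ∂μ, ‖Real.exp (t * D ω)‖ ≤ Real.exp (|t| * c) := by
    intro t
    filter_upwards [hDc] with ω hω
    rw [Real.norm_eq_abs, Real.abs_exp, Real.exp_le_exp]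
    calc t * D ω ≤ |t * D ω| := le_abs_self _
      _ = |t| * |D ω| := abs_mul _ _
      _ ≤ |t| * c := by gcongr
  have hint : ∀ t : ℝ, Integrable (fun ω => Real.exp (t * (S ω + D ω))) μ := by
    intro t
    simp only [mul_add, Real.exp_add]
    exact (hS.integrable_exp_mul t).mul_bdd
      (Real.measurable_exp.comp (hD.const_mul t)).aestronglyMeasurable (hexpD t)
  refine ⟨hint, fun t => ?_⟩
  have hSD : Integrable (fun ω => Real.exp (t * S ω) * D ω) μ :=
    (hS.integrable_exp_mul t).mul_bdd hD.aestronglyMeasurable hDc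
  have hzero : ∫ ω, Real.exp (t * S ω) * D ω ∂μ = 0 := by
    rw [← integral_condExp hm]
    have h := condExp_mul_of_stronglyMeasurable_left (m := m) (μ := μ)
      (f := fun ω => Real.exp (t * S ω)) (g := D)
      (Real.measurable_exp.comp (hSm.const_mul t)).stronglyMeasurable hSD hDint
    refine integral_eq_zero_of_ae ?_
    filter_upwards [h, hD0] with ω h₁ h₂
    have h₃ : (μ[fun ω => Real.exp (t * S ω) * D ω | m]) ω = _ := h₁
    rw [h₃, Pi.mul_apply, h₂]
    simp
  calc mgf (fun ω => S ω + D ω) μ t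
      ≤ ∫ ω, (Real.exp (t * S ω) * Real.cosh (t * c) +
          Real.exp (t * S ω) * D ω * (Real.sinh (t * c) / c)) ∂μ := by
        refine integral_mono_ae (hint t)
          (((hS.integrable_exp_mul t).mul_const _).add (hSD.mul_const _)) ?_
        filter_upwards [hbound t] with ω hω
        simp only [mul_add, Real.exp_add]
        rw [mul_assoc, ← mul_add]
        gcongr
    _ = mgf S μ t * Real.cosh (t * c) := by
        rw [integral_add ((hS.integrable_exp_mul t).mul_const _) (hSD.mul_const _),
          integral_mul_const, integral_mul_const, hzero, zero_mul, add_zero, mgf]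
    _ ≤ Real.exp (V * t ^ 2 / 2) * Real.exp ((t * c) ^ 2 / 2) := by
        gcongr
        · exact hS.mgf_le t
        · exact Real.cosh_le_exp_half_sq _
    _ = Real.exp (((V + c ^ 2 : ℝ≥0) : ℝ) * t ^ 2 / 2) := by
        rw [← Real.exp_add]
        push_cast
        ring_nf

/-- **Azuma's lemma** for bounded martingale differences, on an arbitrary probability space. -/
lemma hasSubgaussianMGF_sum_of_condExp_eq_zero {D : ℕ → Ω → ℝ} {ℱ : ℕ → MeasurableSpace Ω}
    {c : ℕ → ℝ≥0} {N : ℕ} (hℱ : ∀ k < N, ℱ k ≤ mΩ)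
    (hadapted : ∀ k < N, ∀ j < k, Measurable[ℱ k] (D j)) (hD : ∀ k < N, Measurable (D k))
    (hDc : ∀ k < N, ∀ᵐ ω ∂μ, |D k ω| ≤ c k) (hD0 : ∀ k < N, μ[D k | ℱ k] =ᵐ[μ] 0) :
    HasSubgaussianMGF (fun ω => ∑ k ∈ Finset.range N, D k ω)
      (∑ k ∈ Finset.range N, c k ^ 2) μ := by
  induction N with
  | zero => simp
  | succ N ih =>
    simp only [Finset.sum_range_succ]
    refine hasSubgaussianMGF_add_of_condExp_eq_zero (hℱ N N.lt_succ_self)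
      (ih (fun k hk => hℱ k (by omega)) (fun k hk => hadapted k (by omega))
        (fun k hk => hD k (by omega)) (fun k hk => hDc k (by omega))
        (fun k hk => hD0 k (by omega))) ?_ (hD N N.lt_succ_self) (hDc N N.lt_succ_self)
      (hD0 N N.lt_succ_self)
    exact Finset.measurable_fun_sum _ fun j hj =>
      hadapted N N.lt_succ_self j (Finset.mem_range.1 hj)

/-- Two-sided tail bound with confidence level for a sub-Gaussian variable. -/
lemma HasSubgaussianMGF.ofReal_one_sub_le_measure_abs_le {X : Ω → ℝ} {V : ℝ≥0}
    (hX : HasSubgaussianMGF X V μ) (hXm : Measurable X) (hV : 0 < V) {t lam : ℝ} (ht : 0 ≤ t)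
    (hlam : 0 < lam) (htV : 2 * V * Real.log (2 / lam) ≤ t ^ 2) :
    ENNReal.ofReal (1 - lam) ≤ μ {ω | |X ω| ≤ t} := by
  have hexp : Real.exp (-t ^ 2 / (2 * V)) ≤ lam / 2 := by
    rw [← Real.le_log_iff_exp_le (by positivity), ← inv_div 2 lam, Real.log_inv, neg_div,
      neg_le_neg_iff, le_div_iff₀ (by positivity)]
    linarith
  have hset : MeasurableSet {ω | |X ω| ≤ t} :=
    measurableSet_le (continuous_abs.measurable.comp hXm) measurable_const
  have hcompl : μ.real {ω | |X ω| ≤ t}ᶜ ≤ lam := by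
    calc μ.real {ω | |X ω| ≤ t}ᶜ ≤ μ.real ({ω | t ≤ X ω} ∪ {ω | t ≤ (-X) ω}) := by
          refine measureReal_mono fun ω hω => ?_
          have h : t < |X ω| := not_le.1 hω
          rcases lt_abs.1 h with h | h
          · exact Or.inl h.le
          · exact Or.inr h.le
      _ ≤ μ.real {ω | t ≤ X ω} + μ.real {ω | t ≤ (-X) ω} := measureReal_union_le _ _
      _ ≤ lam / 2 + lam / 2 :=
          add_le_add ((hX.measure_ge_le ht).trans hexp) ((hX.neg.measure_ge_le ht).trans hexp)
      _ = lam := by ring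
  rw [probReal_compl_eq_one_sub hset] at hcompl
  refine ENNReal.ofReal_le_of_le_toReal ?_
  change 1 - lam ≤ μ.real _
  linarith

end Azuma

section MeanIndependent

variable {Ω ι : Type*} [MeasurableSpace Ω] {μ : Measure Ω} [IsProbabilityMeasure μ]

/-- A linear combination of tail products of `1 + A k`, where the `A k` are mean independent and
bounded by `u`, is sub-Gaussian around its mean. -/
lemma hasSubgaussianMGF_sum_mul_prod_one_add_sub_one {A : ℕ → Ω → ℝ} {N : ℕ} {u : ℝ≥0}
    (hA0 : A 0 = 0) (hAm : ∀ k, Measurable (A k))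
    (hAu : ∀ k ∈ Finset.Icc 1 N, ∀ᵐ ω ∂μ, |A k ω| ≤ u)
    (hAmi : ∀ k ∈ Finset.Icc 1 N,
      μ[A k | ⨆ j ∈ Finset.Ico 1 k, MeasurableSpace.comap (A j) inferInstance] =ᵐ[μ] 0)
    (T : Finset ι) (b : ι → ℝ) (s : ι → ℕ) {C : ℝ≥0} (hC : ∑ i ∈ T, |b i| ≤ C) :
    HasSubgaussianMGF
      (fun ω => ∑ i ∈ T, b i * (∏ k ∈ Finset.Icc (s i) N, (1 + A k ω) - 1))
      (∑ k ∈ Finset.range N, (C * u * (1 + u) ^ k) ^ 2) μ := by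
  set w : ℕ → Ω → ℝ := fun k ω =>
    ∑ i ∈ T, b i * if s i ≤ k then ∏ j ∈ Finset.Ico (s i) k, (1 + A j ω) else 0 with hw
  set ℱ : ℕ → MeasurableSpace Ω := fun k =>
    ⨆ j ∈ Finset.Ico 1 k, MeasurableSpace.comap (A j) inferInstance with hℱ
  have hle : ∀ k, ℱ k ≤ ‹MeasurableSpace Ω› := fun k =>
    iSup₂_le fun j _ => (hAm j).comap_le
  have hAℱ : ∀ j k, j < k → Measurable[ℱ k] (A j) := by
    intro j k hjk
    rcases Nat.eq_zero_or_pos j with rfl | hj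
    · rw [hA0]; exact measurable_const
    · exact (comap_measurable (A j)).mono
        (le_iSup₂_of_le (f := fun j (_ : j ∈ Finset.Ico 1 k) =>
          MeasurableSpace.comap (A j) inferInstance) j
          (Finset.mem_Ico.2 ⟨hj, hjk⟩) le_rfl) le_rfl
  have hwℱ : ∀ j k, j ≤ k → Measurable[ℱ k] (w j) := by
    intro j k hjk
    refine Finset.measurable_fun_sum _ fun i _ => Measurable.const_mul ?_ _
    split_ifs
    · exact Finset.measurable_fun_prod _ fun l hl =>
        (hAℱ l k ((Finset.mem_Ico.1 hl).2.trans_le hjk)).const_add _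
    · exact measurable_const
  have hwm : ∀ k, Measurable (w k) := fun k => (hwℱ k k le_rfl).mono (hle k) le_rfl
  have hAall : ∀ᵐ ω ∂μ, ∀ k ∈ Finset.Icc 1 N, |A k ω| ≤ u :=
    (Finset.eventually_all _).2 hAu
  have hwb : ∀ k ≤ N, ∀ᵐ ω ∂μ, |w k ω| ≤ C * (1 + u) ^ (k - 1) := by
    intro k hk
    filter_upwards [hAall] with ω hω
    have hprod : ∀ i, |∏ j ∈ Finset.Ico (s i) k, (1 + A j ω)| ≤ (1 + u) ^ (k - 1) := by
      intro i
      rw [← Finset.prod_erase (a := 0) _ (by simp [hA0])]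
      have hsub : (Finset.Ico (s i) k).erase 0 ⊆ Finset.Ico 1 k := by
        intro j; simp only [Finset.mem_erase, Finset.mem_Ico]; omega
      refine (abs_prod_le_pow (Y := 1 + u) fun j hj => ?_).trans
        (pow_le_pow_right₀ (by simp) ((Finset.card_le_card hsub).trans (by simp)))
      have hj' := Finset.mem_Ico.1 (hsub hj)
      calc |1 + A j ω| ≤ |1| + |A j ω| := abs_add_le _ _
        _ ≤ 1 + u := by
          rw [abs_one]
          gcongr
          exact hω j (Finset.mem_Icc.2 ⟨hj'.1, by omega⟩)
    calc |w k ω| ≤ ∑ i ∈ T, |b i| * (1 + u) ^ (k - 1) := by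
          refine (Finset.abs_sum_le_sum_abs _ _).trans (Finset.sum_le_sum fun i _ => ?_)
          rw [abs_mul]
          gcongr
          split_ifs
          · exact hprod i
          · rw [abs_zero]; positivity
      _ = (∑ i ∈ T, |b i|) * (1 + u) ^ (k - 1) := (Finset.sum_mul _ _ _).symm
      _ ≤ C * (1 + u) ^ (k - 1) := by gcongr
  have hsum : (fun ω => ∑ i ∈ T, b i * (∏ k ∈ Finset.Icc (s i) N, (1 + A k ω) - 1)) =
      fun ω => ∑ k ∈ Finset.range N, w (k + 1) ω * A (k + 1) ω := by
    ext ω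
    have h : ∑ i ∈ T, b i * (∏ k ∈ Finset.Icc (s i) N, (1 + A k ω) - 1) =
        ∑ k ∈ Finset.range (N + 1), w k ω * A k ω := by
      simp only [prod_Icc_one_add_sub_one, hw, Finset.mul_sum, Finset.sum_mul]
      rw [Finset.sum_comm]
      refine Finset.sum_congr rfl fun k _ => Finset.sum_congr rfl fun i _ => ?_
      split_ifs <;> ring
    rw [h, Finset.sum_range_succ']
    simp [hA0]
  rw [hsum]
  refine hasSubgaussianMGF_sum_of_condExp_eq_zero (D := fun k ω => w (k + 1) ω * A (k + 1) ω)
    (ℱ := fun k => ℱ (k + 1)) (c := fun k => C * u * (1 + u) ^ k) (fun k _ => hle _)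
    (fun k _ j hj => (hwℱ _ _ (by omega)).mul (hAℱ _ _ (by omega)))
    (fun k _ => (hwm _).mul (hAm _)) (fun k hk => ?_) (fun k hk => ?_)
  · filter_upwards [hwb (k + 1) hk, hAu (k + 1) (by simp; omega)] with ω h₁ h₂
    rw [abs_mul]
    calc |w (k + 1) ω| * |A (k + 1) ω| ≤ (C * (1 + u) ^ k) * u := by
          gcongr
          simpa using h₁
      _ = _ := by push_cast; ring
  · have hAint : Integrable (A (k + 1)) μ :=
      .of_bound (hAm _).aestronglyMeasurable u (hAu (k + 1) (by simp; omega))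
    have h := condExp_stronglyMeasurable_mul_of_bound (hle (k + 1))
      (hwℱ (k + 1) (k + 1) le_rfl).stronglyMeasurable hAint _ (hwb (k + 1) hk)
    filter_upwards [h, hAmi (k + 1) (by simp; omega)] with ω h₁ h₂
    have h₃ : (μ[fun ω => w (k + 1) ω * A (k + 1) ω | ℱ (k + 1)]) ω = _ := h₁
    rw [h₃, Pi.mul_apply, h₂]
    simp

end MeanIndependent

lemma two_mul_sum_sq_le_mul_gammaFn {u : ℝ} (hu : 0 < u) (C : ℝ) (N : ℕ) :
    2 * ∑ k ∈ Finset.range N, (C * u * (1 + u) ^ k) ^ 2 ≤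
      C ^ 2 * (u * gammaFn (2 * N) u) := by
  have hgeom := geom_sum_mul ((1 + u) ^ 2) N
  have hγ : gammaFn (2 * N) u = (∑ k ∈ Finset.range N, ((1 + u) ^ 2) ^ k) * (u * (2 + u)) := by
    rw [gammaFn, pow_mul, ← hgeom]; ring
  have hS : ∑ k ∈ Finset.range N, (C * u * (1 + u) ^ k) ^ 2 =
      C ^ 2 * u ^ 2 * ∑ k ∈ Finset.range N, ((1 + u) ^ 2) ^ k := by
    rw [Finset.mul_sum]
    exact Finset.sum_congr rfl fun k _ => by rw [← pow_mul]; ring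
  rw [hγ, hS]
  have hG : 0 ≤ ∑ k ∈ Finset.range N, ((1 + u) ^ 2) ^ k :=
    Finset.sum_nonneg fun _ _ => by positivity
  have : 0 ≤ C ^ 2 * u ^ 2 * (∑ k ∈ Finset.range N, ((1 + u) ^ 2) ^ k) * u := by positivity
  linarith

/-- Replacing the factors `1 + δ k` by `1 + A k` with `|δ k - A k| ≤ v`, in a linear combination of
tail products. -/
lemma abs_sum_mul_prod_sub_le {ι : Type*} {N : ℕ} {δ A : ℕ → ℝ} {u v : ℝ} (hu : 0 ≤ u)
    (hv : 0 ≤ v) (hδ0 : δ 0 = 0) (hA0 : A 0 = 0) (hA : ∀ k ∈ Finset.Icc 1 N, |A k| ≤ u)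
    (hδA : ∀ k ∈ Finset.Icc 1 N, |δ k - A k| ≤ v) (T : Finset ι) (b : ι → ℝ) (s : ι → ℕ) :
    |∑ i ∈ T, b i * (∏ k ∈ Finset.Icc (s i) N, (1 + δ k) - ∏ k ∈ Finset.Icc (s i) N, (1 + A k))| ≤
      (∑ i ∈ T, |b i|) * (gammaFn N (u + v) - gammaFn N u) := by
  rw [Finset.sum_mul]
  refine (Finset.abs_sum_le_sum_abs _ _).trans (Finset.sum_le_sum fun i _ => ?_)
  rw [abs_mul]
  refine mul_le_mul_of_nonneg_left ?_ (abs_nonneg _)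
  rw [← Finset.prod_erase (a := 0) (f := fun k => 1 + δ k) _ (by simp [hδ0]),
    ← Finset.prod_erase (a := 0) (f := fun k => 1 + A k) _ (by simp [hA0])]
  have hsub : (Finset.Icc (s i) N).erase 0 ⊆ Finset.Icc 1 N := by
    intro j; simp only [Finset.mem_erase, Finset.mem_Icc]; omega
  have hcard : ((Finset.Icc (s i) N).erase 0).card ≤ N :=
    (Finset.card_le_card hsub).trans (by simp)
  have h := abs_prod_sub_prod_le (s := (Finset.Icc (s i) N).erase 0) (x := fun k => 1 + δ k)
    (y := fun k => 1 + A k) (Y := 1 + u) (v := v) (by linarith) hv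
    (fun k hk => (abs_add_le _ _).trans (by
      rw [abs_one]; exact add_le_add_right (hA k (hsub hk)) 1))
    (fun k hk => by simpa using hδA k (hsub hk))
  refine h.trans ((monotone_add_pow_sub_pow (by linarith : 1 ≤ 1 + u) hv hcard).trans_eq ?_)
  simp only [gammaFn]
  ring

/-- Probabilistic error bound for Horner's algorithm under limited-precision
stochastic rounding `SR_{p,r}`: the rounding errors `δ_k` are bounded by
`u_p = 2^(1-p)`, their biases `β_k` by `u_{p+r} = 2^(1-p-r)`, and the centered
errors `α_k = δ_k - β_k` (bounded by `u_p`) are mean independent. With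
probability at least `1 - λ`, the forward error of the computed value
`P̂ = ∑ a_i x^i ∏_{k=2(n-i)}^{2n} (1+δ_k)` is at most
`(∑ |a_i||x|^i) (√(u_p γ_{4n}(u_p)) √(ln(2/λ)) + γ_{2n}(u_p+u_{p+r}) - γ_{2n}(u_p))`. -/
theorem horner_limited_precision_sr_bound {Ω : Type*} [MeasurableSpace Ω]
    (μ : Measure Ω) [IsProbabilityMeasure μ]
    (n p r : ℕ) (hn : 1 ≤ n) (hp : 1 ≤ p) (hr : 1 ≤ r)
    (a : ℕ → ℝ) (x : ℝ) (δ β : ℕ → Ω → ℝ) (hδ0 : δ 0 = 0)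
    (hmeasδ : ∀ k, Measurable (δ k)) (hmeasβ : ∀ k, Measurable (β k))
    (hδbd : ∀ k ∈ Finset.Icc 1 (2 * n),
      ∀ᵐ ω ∂μ, |δ k ω| ≤ (2 : ℝ) ^ (1 - (p : ℤ)))
    (hβbd : ∀ k ∈ Finset.Icc 1 (2 * n),
      ∀ᵐ ω ∂μ, |β k ω| ≤ (2 : ℝ) ^ (1 - (p : ℤ) - (r : ℤ)))
    (hαbd : ∀ k ∈ Finset.Icc 1 (2 * n),
      ∀ᵐ ω ∂μ, |δ k ω - β k ω| ≤ (2 : ℝ) ^ (1 - (p : ℤ)))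
    (hmi : ∀ k ∈ Finset.Icc 1 (2 * n),
      μ[(fun ω => δ k ω - β k ω) | ⨆ j ∈ Finset.Ico 1 k,
          MeasurableSpace.comap (fun ω => δ j ω - β j ω) inferInstance] =ᵐ[μ] 0)
    (lam : ℝ) (hlam0 : 0 < lam) (hlam1 : lam < 1) :
    ENNReal.ofReal (1 - lam) ≤
      μ {ω | |(∑ i ∈ Finset.range (n + 1),
            a i * x ^ i * ∏ k ∈ Finset.Icc (2 * (n - i)) (2 * n), (1 + δ k ω)) -
          ∑ i ∈ Finset.range (n + 1), a i * x ^ i| ≤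
        (∑ i ∈ Finset.range (n + 1), |a i| * |x| ^ i) *
          (Real.sqrt ((2 : ℝ) ^ (1 - (p : ℤ)) *
              gammaFn (4 * n) ((2 : ℝ) ^ (1 - (p : ℤ)))) *
            Real.sqrt (Real.log (2 / lam)) +
          gammaFn (2 * n)
            ((2 : ℝ) ^ (1 - (p : ℤ)) + (2 : ℝ) ^ (1 - (p : ℤ) - (r : ℤ))) -
          gammaFn (2 * n) ((2 : ℝ) ^ (1 - (p : ℤ))))} := by
  set u : ℝ := (2 : ℝ) ^ (1 - (p : ℤ)) with hu_def
  set v : ℝ := (2 : ℝ) ^ (1 - (p : ℤ) - (r : ℤ)) with hv_def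
  have hu : 0 < u := by positivity
  have hv : 0 < v := by positivity
  set b : ℕ → ℝ := fun i => a i * x ^ i with hb
  set s : ℕ → ℕ := fun i => 2 * (n - i) with hs
  set T := Finset.range (n + 1) with hT
  have hC : ∑ i ∈ T, |a i| * |x| ^ i = ∑ i ∈ T, |b i| := by simp [hb, abs_mul, abs_pow]
  rw [hC]
  set C : ℝ := ∑ i ∈ T, |b i| with hC_def
  have hC0 : 0 ≤ C := Finset.sum_nonneg fun _ _ => abs_nonneg _
  set R : ℝ := Real.sqrt (u * gammaFn (4 * n) u) * Real.sqrt (Real.log (2 / lam)) with hR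
  let A : ℕ → Ω → ℝ := fun k => if k = 0 then 0 else fun ω => δ k ω - β k ω
  have hA0 : A 0 = 0 := rfl
  have hA : ∀ k, 1 ≤ k → A k = fun ω => δ k ω - β k ω := fun k hk => if_neg (by omega)
  have hAm : ∀ k, Measurable (A k) := by
    intro k
    rcases Nat.eq_zero_or_pos k with rfl | hk
    · exact measurable_const
    · rw [hA k hk]; exact (hmeasδ k).sub (hmeasβ k)
  have hAu : ∀ k ∈ Finset.Icc 1 (2 * n), ∀ᵐ ω ∂μ, |A k ω| ≤ u := by
    intro k hk
    rw [hA k (Finset.mem_Icc.1 hk).1]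
    exact hαbd k hk
  have hAmi : ∀ k ∈ Finset.Icc 1 (2 * n),
      μ[A k | ⨆ j ∈ Finset.Ico 1 k, MeasurableSpace.comap (A j) inferInstance] =ᵐ[μ] 0 := by
    intro k hk
    have hsup : (⨆ j ∈ Finset.Ico 1 k, MeasurableSpace.comap (A j) inferInstance) =
        ⨆ j ∈ Finset.Ico 1 k, MeasurableSpace.comap (fun ω => δ j ω - β j ω) inferInstance :=
      biSup_congr fun j hj => by rw [hA j (Finset.mem_Ico.1 hj).1]
    rw [hsup, hA k (Finset.mem_Icc.1 hk).1]
    exact hmi k hk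
  set X : Ω → ℝ := fun ω => ∑ i ∈ T, b i * (∏ k ∈ Finset.Icc (s i) (2 * n), (1 + A k ω) - 1)
    with hX
  have hXm : Measurable X :=
    Finset.measurable_fun_sum _ fun i _ => ((Finset.measurable_fun_prod _ fun k _ =>
      (hAm k).const_add 1).sub_const 1).const_mul _
  have hXtail : ENNReal.ofReal (1 - lam) ≤ μ {ω | |X ω| ≤ C * R} := by
    rcases hC0.eq_or_lt with hC00 | hCpos
    · have hb0 : ∀ i ∈ T, b i = 0 := fun i hi => abs_eq_zero.1
        ((Finset.sum_eq_zero_iff_of_nonneg fun _ _ => abs_nonneg _).1 hC00.symm i hi)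
      have hX0 : ∀ ω, X ω = 0 := fun ω => Finset.sum_eq_zero fun i hi => by rw [hb0 i hi, zero_mul]
      simp [hX0, ← hC00, hlam0.le]
    · have hsub := hasSubgaussianMGF_sum_mul_prod_one_add_sub_one (u := ⟨u, hu.le⟩) (C := ⟨C, hC0⟩)
        hA0 hAm hAu hAmi T b s le_rfl
      refine HasSubgaussianMGF.ofReal_one_sub_le_measure_abs_le hsub hXm ?_ (by positivity)
        hlam0 ?_
      · have hu' : (0 : ℝ≥0) < ⟨u, hu.le⟩ := hu
        have hC' : (0 : ℝ≥0) < ⟨C, hC0⟩ := hCpos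
        exact Finset.sum_pos (fun k _ => pow_pos (mul_pos (mul_pos hC' hu')
          (pow_pos (add_pos one_pos hu') k)) 2) ⟨0, Finset.mem_range.2 (by omega)⟩
      · have hL : 0 ≤ Real.log (2 / lam) :=
          Real.log_nonneg (by rw [le_div_iff₀ hlam0]; linarith)
        have hγ : 0 ≤ gammaFn (4 * n) u := sub_nonneg.2 (one_le_pow₀ (by linarith))
        have h := two_mul_sum_sq_le_mul_gammaFn hu C (2 * n)
        rw [show 2 * (2 * n) = 4 * n by ring] at h
        rw [hR, mul_pow, mul_pow, Real.sq_sqrt (by positivity), Real.sq_sqrt hL, ← mul_assoc]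
        refine mul_le_mul_of_nonneg_right ?_ hL
        push_cast
        exact h
  refine hXtail.trans (measure_mono_ae ?_)
  filter_upwards [(Finset.eventually_all _).2 hAu, (Finset.eventually_all _).2 hβbd]
    with ω hAω hβω hXω
  have hXω' : |X ω| ≤ C * R := hXω
  have hdiff := abs_sum_mul_prod_sub_le (δ := fun k => δ k ω) (A := fun k => A k ω) hu.le hv.le
    (by simp [hδ0]) (by simp [hA0]) hAω
    (fun k hk => by
      rw [hA k (Finset.mem_Icc.1 hk).1]
      simpa using hβω k hk) T b s
  change |∑ i ∈ T, b i * ∏ k ∈ Finset.Icc (s i) (2 * n), (1 + δ k ω) - ∑ i ∈ T, b i| ≤ _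
  have hsplit : ∑ i ∈ T, b i * ∏ k ∈ Finset.Icc (s i) (2 * n), (1 + δ k ω) - ∑ i ∈ T, b i =
      X ω + ∑ i ∈ T, b i * (∏ k ∈ Finset.Icc (s i) (2 * n), (1 + δ k ω) -
        ∏ k ∈ Finset.Icc (s i) (2 * n), (1 + A k ω)) := by
    rw [hX, ← Finset.sum_add_distrib, ← Finset.sum_sub_distrib]
    exact Finset.sum_congr rfl fun i _ => by ring
  rw [hsplit]
  calc _ ≤ C * R + C * (gammaFn (2 * n) (u + v) - gammaFn (2 * n) u) :=
        (abs_add_le _ _).trans (add_le_add hXω' hdiff)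
    _ = _ := by ring
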